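/- Let A_cl ∈ ℝ^{n×n}, let P, Q ∈ ℝ^{n×n} be symmetric positive definite, let α > 0 and τ₀, τ₁ > 0 satisfy τ₀ + τ₁/α ≤ 1, and suppose the block matrix [[A_clᵀ P A_cl − τ₀ P, A_clᵀ P], [P A_cl, P − τ₁ Q⁻¹]] ∈ ℝ^{2n×2n} is negative semidefinite. Then the ellipsoid 𝓔_α := {e ∈ ℝⁿ | eᵀ P e ≤ α} is robustly positively invariant for the uncertain dynamics e⁺ = A_cl e + w with w ranging over the ellipsoidal disturbance set 𝕎 := {w ∈ ℝⁿ | wᵀ Q⁻¹ w ≤ 1}; that is, for every e with eᵀ P e ≤ α and every w with wᵀ Q⁻¹ w ≤ 1, one has (A_cl e + w)ᵀ P (A_cl e + w) ≤ α. (S-procedure certificate underlying optimization problem (20) of Section V-B(b) for computing the robust invariant set 𝓔_α.) -/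

import Mathlib

open Matrix

/-- S-procedure certificate underlying optimization problem (20) of Section V-B(b):
the LMI condition together with `τ₀ + τ₁/α ≤ 1` implies that the ellipsoid
`𝓔_α = {e | eᵀ P e ≤ α}` is robustly positively invariant for `e⁺ = A_cl e + w` with
disturbances in the ellipsoid `𝕎 = {w | wᵀ Q⁻¹ w ≤ 1}`. -/
theorem stmt12
    {n : ℕ} (Acl P Q : Matrix (Fin n) (Fin n) ℝ)
    (hP : P.PosDef) (hPsymm : P.IsSymm) (hQ : Q.PosDef) (hQsymm : Q.IsSymm)
    (α τ₀ τ₁ : ℝ) (hα : 0 < α) (hτ₀ : 0 < τ₀) (hτ₁ : 0 < τ₁)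
    (hscal : τ₀ + τ₁ / α ≤ 1)
    (hLMI : (-(Matrix.fromBlocks
        (Aclᵀ * P * Acl - τ₀ • P) (Aclᵀ * P)
        (P * Acl) (P - τ₁ • Q⁻¹))).PosSemidef) :
    ∀ e w : Fin n → ℝ, e ⬝ᵥ P.mulVec e ≤ α → w ⬝ᵥ Q⁻¹.mulVec w ≤ 1 →
      (Acl.mulVec e + w) ⬝ᵥ P.mulVec (Acl.mulVec e + w) ≤ α := by
  intro e w he hw
  have hquad := hLMI.dotProduct_mulVec_nonneg (Sum.elim e w)
  have hA : ∀ x : Fin n → ℝ, e ⬝ᵥ Aclᵀ *ᵥ x = (Acl *ᵥ e) ⬝ᵥ x := fun x => by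
    rw [dotProduct_mulVec, vecMul_transpose]
  simp only [star_trivial, neg_mulVec, dotProduct_neg, fromBlocks_mulVec, Sum.elim_comp_inl,
    Sum.elim_comp_inr, sumElim_dotProduct_sumElim, sub_mulVec, smul_mulVec, dotProduct_add,
    dotProduct_sub, dotProduct_smul, smul_eq_mul, ← mulVec_mulVec, hA] at hquad
  have hτ : τ₀ * α + τ₁ ≤ α := by
    have h := mul_le_mul_of_nonneg_right hscal hα.le
    rwa [add_mul, div_mul_cancel₀ _ hα.ne', one_mul] at h
  have he' := mul_le_mul_of_nonneg_left he hτ₀.le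
  have hw' := mul_le_mul_of_nonneg_left hw hτ₁.le
  simp only [mulVec_add, dotProduct_add, add_dotProduct]
  linarith
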